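/- There exists a constant χ > 0 such that for every non-flat initial triangle T(0), almost surely limsup_{n→∞} (1/n)·ln(Y_n) ≤ −χ; in particular the sequence (Y_n) converges to zero exponentially fast almost surely. -/

import Mathlib

open MeasureTheory ProbabilityTheory Filter Set

noncomputable section

/-- A triangle: an ordered triple of points in the plane (identified with `ℂ`). -/
abbrev Tri : Type := ℂ × ℂ × ℂ

namespace Tri

def A (T : Tri) : ℂ := T.1
def B (T : Tri) : ℂ := T.2.1
def C (T : Tri) : ℂ := T.2.2

/-- The vertices are not all equal. -/
def Nondeg (T : Tri) : Prop := ¬ (T.A = T.B ∧ T.B = T.C)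

/-- The vertices are not collinear. -/
def Nonflat (T : Tri) : Prop := ((T.B - T.A) * (starRingEnd ℂ (T.C - T.A))).im ≠ 0

end Tri

/-- The area of a triangle. -/
def triArea (T : Tri) : ℝ := |((T.B - T.A) * (starRingEnd ℂ (T.C - T.A))).im| / 2

/-- The six triangles of the barycentric subdivision. -/
def subdiv (T : Tri) : Fin 6 → Tri :=
  ![ (T.A, (T.A + T.B)/2, (T.A + T.B + T.C)/3),
     ((T.A + T.B)/2, T.B, (T.A + T.B + T.C)/3),
     (T.B, (T.B + T.C)/2, (T.A + T.B + T.C)/3),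
     ((T.B + T.C)/2, T.C, (T.A + T.B + T.C)/3),
     (T.C, (T.C + T.A)/2, (T.A + T.B + T.C)/3),
     ((T.C + T.A)/2, T.A, (T.A + T.B + T.C)/3) ]

/-- Edge lengths. -/
def e₁ (T : Tri) : ℝ := ‖T.A - T.B‖
def e₂ (T : Tri) : ℝ := ‖T.B - T.C‖
def e₃ (T : Tri) : ℝ := ‖T.C - T.A‖

/-- Largest edge length. -/
def Lmax (T : Tri) : ℝ := max (e₁ T) (max (e₂ T) (e₃ T))
/-- Smallest edge length. -/
def Lmin (T : Tri) : ℝ := min (e₁ T) (min (e₂ T) (e₃ T))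
/-- Middle edge length. -/
def Lmid (T : Tri) : ℝ := e₁ T + e₂ T + e₃ T - Lmax T - Lmin T

/-- Abscissa of the characterizing point. -/
def charX (T : Tri) : ℝ := ((Lmax T)^2 + (Lmin T)^2 - (Lmid T)^2) / (2 * (Lmax T)^2)
/-- Ordinate of the characterizing point. -/
def charY (T : Tri) : ℝ := 2 * triArea T / (Lmax T)^2

variable {Ω : Type*}

/-- The triangle Markov chain driven by the choices `ι`. -/
def triChain (ι : ℕ → Ω → Fin 6) (T0 : Tri) : ℕ → Ω → Tri
  | 0 => fun _ => T0
  | n+1 => fun ω => subdiv (triChain ι T0 n ω) (ι (n+1) ω)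

/-- `ι` is an i.i.d. sequence of uniform `{1,…,6}`-valued random variables. -/
def IsIIDUniform [MeasurableSpace Ω] (P : Measure Ω) (ι : ℕ → Ω → Fin 6) : Prop :=
  (∀ n, Measurable (ι n)) ∧
  iIndepFun ι P ∧
  (∀ n (i : Fin 6), P {ω | ι n ω = i} = 1/6)

/-- The six maps of the flat-triangle iterated function system. -/
def zfun : Fin 6 → ℝ → ℝ :=
  ![ fun x => 3*x/(2+2*x),
     fun x => if x < 2/7 then 3*x/(2-x) else (2-4*x)/(2-x),
     fun x => if x < 1/5 then (1+x)/(3-3*x) else (2-4*x)/(3-3*x),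
     fun x => (1+x)/(4-2*x),
     fun x => (1-2*x)/(4-2*x),
     fun x => (1-2*x)/3 ]

/-- The flat-triangle Markov chain driven by the choices `ι`. -/
def flatChain (ι : ℕ → Ω → Fin 6) (z0 : ℝ) : ℕ → Ω → ℝ
  | 0 => fun _ => z0
  | n+1 => fun ω => zfun (ι (n+1) ω) (flatChain ι z0 n ω)

/-- The function `G` of the paper. -/
def Gfun : Fin 6 → ℝ → ℝ :=
  ![ fun x => Real.sqrt (2/3) * (1+x),
     fun x => Real.sqrt (1/6) * (2-x),
     fun x => Real.sqrt (3/2) * (1-x),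
     fun x => Real.sqrt (2/3) * (2-x),
     fun x => Real.sqrt (2/3) * (2-x),
     fun _ => Real.sqrt (3/2) ]



namespace TriFlat

/-- Sum of squared edge lengths. -/
def Q (T : Tri) : ℝ :=
  Complex.normSq (T.A - T.B) + Complex.normSq (T.B - T.C) + Complex.normSq (T.C - T.A)

lemma area_subdiv (T : Tri) (i : Fin 6) : triArea (subdiv T i) = triArea T / 6 := by
  have h : ((((subdiv T i).B - (subdiv T i).A) *
      (starRingEnd ℂ ((subdiv T i).C - (subdiv T i).A))).im)
      = ((T.B - T.A) * (starRingEnd ℂ (T.C - T.A))).im / 6 := by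
    rw [Complex.mul_im, Complex.mul_im]
    simp only [Complex.conj_re, Complex.conj_im]
    fin_cases i <;> simp [subdiv, Tri.A, Tri.B, Tri.C] <;> ring
  unfold triArea
  rw [h, abs_div, abs_of_pos (by norm_num : (0:ℝ) < 6)]
  ring

lemma area_pos {T : Tri} (h : T.Nonflat) : 0 < triArea T := by
  unfold triArea
  have := abs_pos.mpr h
  linarith

/-- The pairs of squared edges attached to the six small triangles. -/
def pr (a b c : ℝ) : Fin 6 → ℝ :=
  ![5 * (a+b+c) + 3 * c - 6 * a, 5 * (a+b+c) + 3 * c - 6 * b, 5 * (a+b+c) + 3 * a - 6 * b,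
    5 * (a+b+c) + 3 * a - 6 * c, 5 * (a+b+c) + 3 * b - 6 * c, 5 * (a+b+c) + 3 * b - 6 * a]

lemma Q_subdiv (T : Tri) (i : Fin 6) : 18 * Q (subdiv T i) =
    pr (Complex.normSq (T.B - T.C)) (Complex.normSq (T.C - T.A)) (Complex.normSq (T.A - T.B)) i := by
  fin_cases i <;> simp [subdiv, Q, pr, Tri.A, Tri.B, Tri.C, Complex.normSq_apply] <;> ring

lemma heron (T : Tri) :
    let a := Complex.normSq (T.B - T.C)
    let b := Complex.normSq (T.C - T.A)
    let c := Complex.normSq (T.A - T.B)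
    2 * (a*b+b*c+c*a) - (a^2+b^2+c^2) = 16 * triArea T ^ 2 := by
  simp only [triArea, div_pow, sq_abs]
  simp [Tri.A, Tri.B, Tri.C, Complex.normSq_apply]
  ring

lemma Q_pos {T : Tri} (h : 0 < triArea T) : 0 < Q T := by
  have h1 := heron T
  have h2 : 0 ≤ Q T := by
    unfold Q
    have := Complex.normSq_nonneg
    exact add_nonneg (add_nonneg (this _) (this _)) (this _)
  rcases h2.lt_or_eq with h3 | h3
  · exact h3
  · exfalso
    simp only at h1
    unfold Q at h3
    have ha := Complex.normSq_nonneg (T.B - T.C)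
    have hb := Complex.normSq_nonneg (T.C - T.A)
    have hc := Complex.normSq_nonneg (T.A - T.B)
    have ha' : Complex.normSq (T.B - T.C) = 0 := by linarith
    have hb' : Complex.normSq (T.C - T.A) = 0 := by linarith
    have hc' : Complex.normSq (T.A - T.B) = 0 := by linarith
    rw [ha', hb', hc'] at h1
    nlinarith

lemma bound1 (u v : ℝ) (h : u^2+u*v+v^2 ≤ 1/12) : |3*u+v| ≤ 0.9 := by
  apply abs_le_of_sq_le_sq _ (by norm_num)
  nlinarith [sq_nonneg (u+5*v)]

lemma cubic (u v : ℝ) (h : u^2+u*v+v^2 ≤ 1/12) :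
    1.05 ≤ (4/3 - 3*u - v) * (4/3 + u - 2*v) * (4/3 + 2*u + 3*v) := by
  have hb := abs_le.mp (bound1 u v h)
  set k := 7 * (u^2+u*v+v^2) with hk
  set y := -(3*u+v) with hy
  have hk0 : 0 ≤ k := by nlinarith [sq_nonneg (u+v), sq_nonneg u, sq_nonneg v]
  have hk1 : k ≤ 7/12 := by linarith
  have hyk : y^2 ≤ 4*k/3 := by
    rw [hy, hk]; nlinarith [sq_nonneg (u+5*v)]
  have e : (4/3 - 3*u - v) * (4/3 + u - 2*v) * (4/3 + 2*u + 3*v)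
      = 64/27 - 4/3 * k + y * (y^2 - k) := by
    rw [hy, hk]; ring
  rw [e]
  have hy1 : -0.9 ≤ y := by linarith [hb.2]
  have hy2 : y ≤ 0.9 := by linarith [hb.1]
  rcases le_total 0 y with h0 | h0
  · have : 0 ≤ y * y^2 := by positivity
    nlinarith [mul_nonneg h0 (sub_nonneg.mpr hk1)]
  · have h3 : (-y) * (y^2 - k) ≤ (-y) * (k/3) :=
      mul_le_mul_of_nonneg_left (by linarith) (by linarith)
    nlinarith [mul_nonneg (neg_nonneg.mpr h0) (sub_nonneg.mpr hk1)]

/-- Growth ratio. -/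
def ratio (T : Tri) (i : Fin 6) : ℝ := 6 * Q (subdiv T i) / Q T

set_option maxHeartbeats 2000000 in
lemma ratio_facts {T : Tri} (h : 0 < triArea T) :
    (∀ i, 0.4 ≤ ratio T i ∧ ratio T i ≤ 2.5) ∧
    1.05 ≤ ratio T 0 * ratio T 2 * ratio T 4 ∧ 1.05 ≤ ratio T 1 * ratio T 3 * ratio T 5 := by
  have hq := Q_pos h
  have hH := heron T
  have hr : ∀ i, ratio T i = pr (Complex.normSq (T.B - T.C)) (Complex.normSq (T.C - T.A))
      (Complex.normSq (T.A - T.B)) i / (3 * Q T) := by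
    intro i
    rw [← Q_subdiv, ratio]; field_simp; ring
  have hQ : Q T = Complex.normSq (T.B - T.C) + Complex.normSq (T.C - T.A) +
      Complex.normSq (T.A - T.B) := by unfold Q; ring
  simp only at hH
  generalize Complex.normSq (T.B - T.C) = a at *
  generalize Complex.normSq (T.C - T.A) = b at *
  generalize Complex.normSq (T.A - T.B) = c at *
  generalize Q T = S at *
  obtain ⟨u, hu⟩ : ∃ u, u = a / S - 1/3 := ⟨_, rfl⟩
  obtain ⟨v, hv⟩ : ∃ v, v = b / S - 1/3 := ⟨_, rfl⟩
  have ha : a = (u + 1/3) * S := by rw [hu]; field_simp; ring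
  have hb : b = (v + 1/3) * S := by rw [hv]; field_simp; ring
  have hc : c = (1/3 - u - v) * S := by linarith
  have huv : u^2+u*v+v^2 ≤ 1/12 := by
    have h0 : 0 ≤ (1/12 - (u^2+u*v+v^2)) * S^2 := by
      rw [ha, hb, hc] at hH
      nlinarith [sq_nonneg (triArea T)]
    have := nonneg_of_mul_nonneg_left h0 (by positivity)
    linarith
  have hS : a + b + c = S := hQ.symm
  have r0 : ratio T 0 = 4/3 - 3*u - v := by
    rw [hr]; simp only [pr, hS]; simp; rw [ha, hc]; field_simp; ring
  have r1 : ratio T 1 = 4/3 - u - 3*v := by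
    rw [hr]; simp only [pr, hS]; simp; rw [hb, hc]; field_simp; ring
  have r2 : ratio T 2 = 4/3 + u - 2*v := by
    rw [hr]; simp only [pr, hS]; simp; rw [ha, hb]; field_simp; ring
  have r3 : ratio T 3 = 4/3 + 3*u + 2*v := by
    rw [hr]; simp only [pr, hS]; simp; rw [ha, hc]; field_simp; ring
  have r4 : ratio T 4 = 4/3 + 2*u + 3*v := by
    rw [hr]; simp only [pr, hS]; simp; rw [hb, hc]; field_simp; ring
  have r5 : ratio T 5 = 4/3 - 2*u + v := by
    rw [hr]; simp only [pr, hS]; simp; rw [ha, hb]; field_simp; ring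
  refine ⟨?_, ?_, ?_⟩
  · have b0 := abs_le.mp (bound1 u v huv)
    have b1 := abs_le.mp (bound1 v u (by linarith))
    have b2 := abs_le.mp (bound1 u (-u-v) (by nlinarith))
    have b3 := abs_le.mp (bound1 (-u-v) u (by nlinarith))
    have b4 := abs_le.mp (bound1 (-u-v) v (by nlinarith))
    have b5 := abs_le.mp (bound1 v (-u-v) (by nlinarith))
    intro i
    fin_cases i
    · change 0.4 ≤ ratio T 0 ∧ ratio T 0 ≤ 2.5
      rw [r0]; constructor <;> linarith [b0.1, b0.2]
    · change 0.4 ≤ ratio T 1 ∧ ratio T 1 ≤ 2.5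
      rw [r1]; constructor <;> linarith [b1.1, b1.2]
    · change 0.4 ≤ ratio T 2 ∧ ratio T 2 ≤ 2.5
      rw [r2]; constructor <;> linarith [b5.1, b5.2]
    · change 0.4 ≤ ratio T 3 ∧ ratio T 3 ≤ 2.5
      rw [r3]; constructor <;> linarith [b4.1, b4.2]
    · change 0.4 ≤ ratio T 4 ∧ ratio T 4 ≤ 2.5
      rw [r4]; constructor <;> linarith [b3.1, b3.2]
    · change 0.4 ≤ ratio T 5 ∧ ratio T 5 ≤ 2.5
      rw [r5]; constructor <;> linarith [b2.1, b2.2]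
  · rw [r0, r2, r4]; exact cubic u v huv
  · rw [r1, r3, r5]
    refine (cubic v u (by linarith)).trans (le_of_eq (by ring))

/-- Drift constant. -/
def c0 : ℝ := Real.log 1.05

/-- Moment exponent. -/
def s0 : ℝ := c0 / 6

lemma c0_pos : 0 < c0 := Real.log_pos (by norm_num)

lemma c0_lt : c0 < 1 := by
  have := Real.log_le_sub_one_of_pos (by norm_num : (0:ℝ) < 1.05)
  unfold c0; linarith

/-- Normalised area. -/
def Z (T : Tri) : ℝ := triArea T / Q T

/-- Lyapunov function. -/
def F (T : Tri) : ℝ := Real.exp (s0 * Real.log (Z T))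

lemma Z_pos {T : Tri} (h : 0 < triArea T) : 0 < Z T := div_pos h (Q_pos h)

lemma area_subdiv_pos {T : Tri} (h : 0 < triArea T) (i : Fin 6) : 0 < triArea (subdiv T i) := by
  rw [area_subdiv]; linarith

lemma Z_subdiv {T : Tri} (h : 0 < triArea T) (i : Fin 6) :
    Z (subdiv T i) = Z T / ratio T i := by
  have h1 := Q_pos h
  have h2 := Q_pos (area_subdiv_pos h i)
  unfold Z ratio
  rw [area_subdiv]; field_simp

lemma abs_log_le {x : ℝ} (h1 : 0.4 ≤ x) (h2 : x ≤ 2.5) : |Real.log x| ≤ 1 := by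
  have hx : 0 < x := by linarith
  have he := Real.exp_one_gt_d9
  rw [abs_le]
  constructor
  · rw [Real.le_log_iff_exp_le hx, Real.exp_neg]
    refine le_trans ?_ h1
    rw [inv_le_comm₀ (by positivity) (by norm_num)]
    norm_num; linarith
  · rw [Real.log_le_iff_le_exp hx]; linarith

lemma F_subdiv_le {T : Tri} (h : 0 < triArea T) (i : Fin 6) :
    F (subdiv T i) ≤ F T * (1 - s0 * Real.log (ratio T i) + s0^2) := by
  have hr := (ratio_facts h).1 i
  have hr0 : 0 < ratio T i := by linarith [hr.1]
  have hl := abs_log_le hr.1 hr.2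
  unfold F
  rw [Z_subdiv h, Real.log_div (Z_pos h).ne' hr0.ne', mul_sub, sub_eq_add_neg, Real.exp_add]
  apply mul_le_mul_of_nonneg_left _ (Real.exp_pos _).le
  have hs : 0 ≤ s0 ∧ s0 ≤ 1 := by
    unfold s0; constructor <;> linarith [c0_pos, c0_lt]
  have hsl : |-(s0 * Real.log (ratio T i))| ≤ s0 := by
    rw [abs_neg, abs_mul, abs_of_nonneg hs.1]
    exact mul_le_of_le_one_right hs.1 hl
  have h3 := Real.abs_exp_sub_one_sub_id_le (hsl.trans hs.2)
  have h4 := (abs_le.mp h3).2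
  have h5 : (-(s0 * Real.log (ratio T i)))^2 ≤ s0^2 := by
    rw [← sq_abs]; gcongr
  linarith

/-- Contraction factor. -/
def rho : ℝ := 1 - c0^2/36

lemma F_sum_le {T : Tri} (h : 0 < triArea T) : ∑ i, F (subdiv T i) ≤ 6 * rho * F T := by
  have hF : 0 < F T := Real.exp_pos _
  have h1 : ∑ i, F (subdiv T i) ≤ ∑ i, F T * (1 - s0 * Real.log (ratio T i) + s0^2) :=
    Finset.sum_le_sum fun i _ => F_subdiv_le h i
  refine h1.trans ?_
  obtain ⟨hr, ha, hb⟩ := ratio_facts h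
  have hn : ∀ i, ratio T i ≠ 0 := fun i => by have := (hr i).1; intro h0; rw [h0] at this; norm_num at this
  have la := Real.log_le_log (by norm_num) ha
  have lb := Real.log_le_log (by norm_num) hb
  rw [Real.log_mul (mul_ne_zero (hn _) (hn _)) (hn _), Real.log_mul (hn _) (hn _)] at la lb
  rw [← Finset.mul_sum, mul_comm]
  apply mul_le_mul_of_nonneg_right _ hF.le
  have hc := c0_pos
  simp only [Fin.sum_univ_six]
  have hs : 0 < s0 := by unfold s0; linarith
  have hsum : 2 * c0 ≤ Real.log (ratio T 0) + Real.log (ratio T 1) + Real.log (ratio T 2) +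
      Real.log (ratio T 3) + Real.log (ratio T 4) + Real.log (ratio T 5) := by
    unfold c0; linarith
  have := mul_le_mul_of_nonneg_left hsum hs.le
  have e1 : s0 * (2 * c0) = c0^2/3 := by unfold s0; ring
  have e2 : s0^2 = c0^2/36 := by unfold s0; ring
  rw [e1] at this
  rw [e2]; unfold rho
  nlinarith

lemma Q_le (T : Tri) : Q T ≤ 3 * Lmax T ^ 2 ∧ Lmax T ^ 2 ≤ Q T := by
  have h1 : 0 ≤ e₁ T := norm_nonneg _
  have h2 : 0 ≤ e₂ T := norm_nonneg _
  have h3 : 0 ≤ e₃ T := norm_nonneg _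
  have hQ : Q T = e₁ T ^ 2 + e₂ T ^ 2 + e₃ T ^ 2 := by
    simp only [Q, e₁, e₂, e₃, Complex.normSq_eq_norm_sq]
  have l1 : e₁ T ≤ Lmax T := le_max_left _ _
  have l2 : e₂ T ≤ Lmax T := (le_max_left _ _).trans (le_max_right _ _)
  have l3 : e₃ T ≤ Lmax T := (le_max_right _ _).trans (le_max_right _ _)
  rw [hQ]
  constructor
  · nlinarith
  · unfold Lmax
    rcases max_choice (e₁ T) (max (e₂ T) (e₃ T)) with h | h
    · rw [h]; nlinarith
    · rw [h]
      rcases max_choice (e₂ T) (e₃ T) with h | h <;> rw [h] <;> nlinarith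

lemma charY_bounds {T : Tri} (h : 0 < triArea T) : charY T ≤ 6 * Z T ∧ 2 * Z T ≤ charY T := by
  have hq := Q_pos h
  obtain ⟨h1, h2⟩ := Q_le T
  have hL : 0 < Lmax T ^ 2 := by linarith
  unfold charY Z
  constructor
  · rw [← mul_div_assoc, div_le_div_iff₀ hL hq]; nlinarith
  · rw [← mul_div_assoc, div_le_div_iff₀ hq hL]; nlinarith

/-- Deterministic chain along a path. -/
def path (T0 : Tri) (f : ℕ → Fin 6) : ℕ → Tri
  | 0 => T0
  | n+1 => subdiv (path T0 f n) (f (n+1))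

lemma path_congr (T0 : Tri) (f g : ℕ → Fin 6) (n : ℕ) (h : ∀ k ≤ n, f k = g k) :
    path T0 f n = path T0 g n := by
  induction n with
  | zero => rfl
  | succ n ih =>
    simp only [path]
    rw [ih fun k hk => h k (by omega), h (n+1) le_rfl]

lemma triChain_eq {Ω : Type} (ι : ℕ → Ω → Fin 6) (T0 : Tri) (n : ℕ) (ω : Ω) :
    triChain ι T0 n ω = path T0 (fun k => ι k ω) n := by
  induction n with
  | zero => rfl
  | succ n ih => simp only [path, triChain, ih]

lemma chain_area_pos {Ω : Type} (ι : ℕ → Ω → Fin 6) {T0 : Tri} (h : 0 < triArea T0) (n : ℕ)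
    (ω : Ω) : 0 < triArea (triChain ι T0 n ω) := by
  induction n with
  | zero => exact h
  | succ n ih => exact area_subdiv_pos ih _

lemma chain_indep {Ω : Type} [MeasurableSpace Ω] {P : Measure Ω} {ι : ℕ → Ω → Fin 6}
    (hι : IsIIDUniform P ι) (T0 : Tri) (n : ℕ) (f : Tri → ENNReal) (g : Fin 6 → ENNReal) :
    Measurable (fun ω => f (triChain ι T0 n ω)) ∧
    IndepFun (fun ω => g (ι (n+1) ω)) (fun ω => f (triChain ι T0 n ω)) P := by
  obtain ⟨hm, hi, -⟩ := hι
  let ψ : ((i : Finset.range (n+1)) → Fin 6) → ENNReal := fun t =>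
    f (path T0 (fun k => if h : k ∈ Finset.range (n+1) then t ⟨k, h⟩ else 0) n)
  let φ : ((i : ({n+1} : Finset ℕ)) → Fin 6) → ENNReal := fun t => g (t ⟨n+1, by simp⟩)
  have hψ : Measurable ψ := measurable_of_countable _
  have hφ : Measurable φ := measurable_of_countable _
  have e : (fun ω => f (triChain ι T0 n ω)) =
      ψ ∘ (fun ω (i : Finset.range (n+1)) => ι i ω) := by
    funext ω
    simp only [Function.comp, ψ, triChain_eq]
    congr 1
    apply path_congr
    intro k hk
    simp [Nat.lt_succ_of_le hk]
  constructor
  · rw [e]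
    exact hψ.comp (measurable_pi_lambda _ fun i => hm i)
  · rw [e]
    have := hi.indepFun_finset ({n+1} : Finset ℕ) (Finset.range (n+1)) (by simp) hm
    exact this.comp hφ hψ

lemma expect_step {Ω : Type} [MeasurableSpace Ω] {P : Measure Ω}
    {ι : ℕ → Ω → Fin 6} (hι : IsIIDUniform P ι) {T0 : Tri} (h0 : 0 < triArea T0) (n : ℕ) :
    ∫⁻ ω, ENNReal.ofReal (F (triChain ι T0 (n+1) ω)) ∂P ≤
      ENNReal.ofReal rho * ∫⁻ ω, ENNReal.ofReal (F (triChain ι T0 n ω)) ∂P := by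
  have hm := hι.1
  have e1 : ∀ ω, ENNReal.ofReal (F (triChain ι T0 (n+1) ω)) =
      ∑ i : Fin 6, (if ι (n+1) ω = i then 1 else 0) *
        ENNReal.ofReal (F (subdiv (triChain ι T0 n ω) i)) := by
    intro ω; simp [triChain]
  have hi := fun i : Fin 6 => chain_indep hι T0 n
    (fun T => ENNReal.ofReal (F (subdiv T i))) (fun j => if j = i then 1 else 0)
  have hg : ∀ i : Fin 6, Measurable (fun ω => (if ι (n+1) ω = i then 1 else 0 : ENNReal)) :=
    fun i => (measurable_of_countable (fun j : Fin 6 => (if j = i then 1 else 0 : ENNReal))).comp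
      (hm (n+1))
  have hP : ∀ i : Fin 6, ∫⁻ ω, (if ι (n+1) ω = i then 1 else 0 : ENNReal) ∂P = 1/6 := by
    intro i
    have hs : MeasurableSet {ω | ι (n+1) ω = i} := hm (n+1) (measurableSet_singleton i)
    rw [← hι.2.2 (n+1) i, ← lintegral_indicator_one hs]
    simp [Set.indicator_apply]
  calc ∫⁻ ω, ENNReal.ofReal (F (triChain ι T0 (n+1) ω)) ∂P
      = ∑ i : Fin 6, ∫⁻ ω, (if ι (n+1) ω = i then 1 else 0) *
        ENNReal.ofReal (F (subdiv (triChain ι T0 n ω) i)) ∂P := by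
        rw [← lintegral_finsetSum]
        · simp_rw [e1]
        · intro i _; exact (hg i).mul (hi i).1
    _ = ∑ i : Fin 6, (1/6) * ∫⁻ ω, ENNReal.ofReal (F (subdiv (triChain ι T0 n ω) i)) ∂P := by
        refine Finset.sum_congr rfl fun i _ => ?_
        rw [← hP i]
        exact lintegral_mul_eq_lintegral_mul_lintegral_of_indepFun (hg i) (hi i).1 (hi i).2
    _ = ∫⁻ ω, (1/6) * ∑ i : Fin 6, ENNReal.ofReal (F (subdiv (triChain ι T0 n ω) i)) ∂P := by
        rw [← Finset.mul_sum, ← lintegral_finsetSum _ fun i _ => (hi i).1,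
          lintegral_const_mul _ (Finset.measurable_sum _ fun i _ => (hi i).1)]
    _ ≤ ∫⁻ ω, ENNReal.ofReal rho * ENNReal.ofReal (F (triChain ι T0 n ω)) ∂P := by
        apply lintegral_mono
        intro ω
        have h1 := F_sum_le (chain_area_pos ι h0 n ω)
        have hr : 0 ≤ rho := by unfold rho; nlinarith [c0_pos, c0_lt]
        have h6 : (1/6 : ENNReal) = ENNReal.ofReal (1/6) := by
          rw [ENNReal.ofReal_div_of_pos (by norm_num)]; simp
        simp only
        have hF : ∀ T, 0 ≤ F T := fun T => (Real.exp_pos _).le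
        rw [← ENNReal.ofReal_sum_of_nonneg fun i _ => hF _, h6,
          ← ENNReal.ofReal_mul (by norm_num), ← ENNReal.ofReal_mul hr]
        apply ENNReal.ofReal_le_ofReal
        linarith
    _ = _ := lintegral_const_mul _ (chain_indep hι T0 n (fun T => ENNReal.ofReal (F T)) 0).1

/-- Exponential rate. -/
def rr : ℝ := 1 + c0^2/36

lemma ae_tendsto {Ω : Type} [MeasurableSpace Ω] {P : Measure Ω} [IsProbabilityMeasure P]
    {ι : ℕ → Ω → Fin 6} (hι : IsIIDUniform P ι) {T0 : Tri} (h0 : 0 < triArea T0) :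
    ∀ᵐ ω ∂P, Tendsto (fun n => ENNReal.ofReal (rr^n * F (triChain ι T0 n ω))) atTop (nhds 0) := by
  have hr : 0 ≤ rho := by unfold rho; nlinarith [c0_pos, c0_lt]
  have hrr : 0 ≤ rr := by unfold rr; positivity
  have hE : ∀ n, ∫⁻ ω, ENNReal.ofReal (F (triChain ι T0 n ω)) ∂P ≤
      ENNReal.ofReal (rho^n * F T0) := by
    intro n
    induction n with
    | zero => simp [triChain]
    | succ n ih =>
      refine (expect_step hι h0 n).trans ?_
      rw [pow_succ', mul_assoc, ENNReal.ofReal_mul hr]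
      gcongr
  have hm : ∀ n, Measurable fun ω => ENNReal.ofReal (rr^n * F (triChain ι T0 n ω)) :=
    fun n => (chain_indep hι T0 n (fun T => ENNReal.ofReal (rr^n * F T)) 0).1
  have hq : rr * rho < 1 := by unfold rr rho; nlinarith [pow_pos c0_pos 4]
  have hsum : ∫⁻ ω, ∑' n, ENNReal.ofReal (rr^n * F (triChain ι T0 n ω)) ∂P ≠ ⊤ := by
    rw [lintegral_tsum fun n => (hm n).aemeasurable]
    have hb : ∀ n, ∫⁻ ω, ENNReal.ofReal (rr^n * F (triChain ι T0 n ω)) ∂P ≤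
        ENNReal.ofReal ((rr*rho)^n * F T0) := by
      intro n
      simp_rw [ENNReal.ofReal_mul (pow_nonneg hrr n)]
      rw [lintegral_const_mul _ (chain_indep hι T0 n (fun T => ENNReal.ofReal (F T)) 0).1,
        mul_pow, mul_assoc, ENNReal.ofReal_mul (pow_nonneg hrr n)]
      gcongr
      exact hE n
    refine ne_top_of_le_ne_top ?_ (ENNReal.tsum_le_tsum hb)
    exact ((summable_geometric_of_lt_one (mul_nonneg hrr hr) hq).mul_right _).tsum_ofReal_ne_top
  filter_upwards [ae_lt_top (Measurable.tsum hm) hsum] with ω hω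
  exact ENNReal.tendsto_atTop_zero_of_tsum_ne_top hω.ne

end TriFlat

/-- **Theorem 1 of the paper.** There is a constant `χ > 0` such that for every non-flat
initial triangle, almost surely `limsup (ln Y_n)/n ≤ -χ`: the ordinates of the
characterizing points converge to zero exponentially fast. -/
theorem flatness_as_exponential :
    ∃ χ : ℝ, 0 < χ ∧
      ∀ (Ω : Type) (_ : MeasurableSpace Ω) (P : Measure Ω), IsProbabilityMeasure P →
        ∀ (ι : ℕ → Ω → Fin 6), IsIIDUniform P ι →
          ∀ T0 : Tri, T0.Nonflat →
            ∀ᵐ ω ∂P,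
              Filter.limsup (fun n : ℕ => Real.log (charY (triChain ι T0 n ω)) / n) atTop
                ≤ -χ := by
  have hc := TriFlat.c0_pos
  have hs : 0 < TriFlat.s0 := by unfold TriFlat.s0; linarith
  have hrr : 1 < TriFlat.rr := by unfold TriFlat.rr; nlinarith
  refine ⟨Real.log TriFlat.rr / TriFlat.s0, div_pos (Real.log_pos hrr) hs, ?_⟩
  intro Ω _ P hP ι hι T0 hT
  have h0 := TriFlat.area_pos hT
  filter_upwards [TriFlat.ae_tendsto hι h0] with ω hω
  have hpos := fun n => TriFlat.chain_area_pos ι h0 n ω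
  have hlow : ∀ n : ℕ, Real.log (TriFlat.Z T0) - n ≤
      Real.log (TriFlat.Z (triChain ι T0 n ω)) := by
    intro n
    induction n with
    | zero => simp [triChain]
    | succ n ih =>
      have hr := (TriFlat.ratio_facts (hpos n)).1 (ι (n+1) ω)
      have hl := (abs_le.mp (TriFlat.abs_log_le hr.1 hr.2)).2
      have hr0 : TriFlat.ratio (triChain ι T0 n ω) (ι (n+1) ω) ≠ 0 := by
        have := hr.1
        intro h0; rw [h0] at this; norm_num at this
      simp only [triChain]
      rw [TriFlat.Z_subdiv (hpos n), Real.log_div (TriFlat.Z_pos (hpos n)).ne' hr0]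
      push_cast
      linarith
  have hlogY : ∀ n : ℕ, Real.log (TriFlat.Z T0) - n ≤ Real.log (charY (triChain ι T0 n ω)) := by
    intro n
    refine (hlow n).trans (Real.log_le_log (TriFlat.Z_pos (hpos n)) ?_)
    linarith [(TriFlat.charY_bounds (hpos n)).2, TriFlat.Z_pos (hpos n)]
  apply Filter.limsup_le_of_le
  · apply Filter.IsBoundedUnder.isCoboundedUnder_le
    refine ⟨-|Real.log (TriFlat.Z T0)| - 1, ?_⟩
    rw [Filter.eventually_map]
    filter_upwards [Filter.eventually_ge_atTop 1] with n hn
    have hn' : (1:ℝ) ≤ n := by exact_mod_cast hn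
    show _ ≤ _
    rw [le_div_iff₀ (by linarith)]
    have := neg_abs_le (Real.log (TriFlat.Z T0))
    nlinarith [hlogY n, abs_nonneg (Real.log (TriFlat.Z T0))]
  · have hev := hω.eventually (gt_mem_nhds
      (ENNReal.ofReal_pos.mpr (Real.exp_pos (-(TriFlat.s0 * Real.log 6)))))
    filter_upwards [hev, Filter.eventually_ge_atTop 1] with n hn hn1
    have hn' : (1:ℝ) ≤ n := by exact_mod_cast hn1
    have h1 := (ENNReal.ofReal_lt_ofReal_iff (Real.exp_pos _)).mp hn
    have hF : 0 < TriFlat.F (triChain ι T0 n ω) := Real.exp_pos _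
    have hrn : 0 < TriFlat.rr ^ n := by positivity
    have h2 := Real.log_lt_log (mul_pos hrn hF) h1
    rw [Real.log_exp, Real.log_mul hrn.ne' hF.ne', Real.log_pow, TriFlat.F, Real.log_exp] at h2
    have hZ := TriFlat.Z_pos (hpos n)
    have hY := TriFlat.charY_bounds (hpos n)
    have h3 := Real.log_le_log (by linarith) hY.1
    rw [Real.log_mul (by norm_num) hZ.ne'] at h3
    rw [div_le_iff₀ (by linarith), ← neg_div, div_mul_eq_mul_div, le_div_iff₀ hs]
    nlinarith

end
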